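/- In any feasible SACRP solution, consider a cycle c with batch Y, list the distinct heights of targets of Y at the start of the cycle as h_1 < … < h_k, and for each i set s_i = max{ s(b) : b ∈ Y, h_c(b) = h_i }. Then there exists an index ℓ ∈ {1,…,k} such that s_1 ≤ s_2 ≤ … ≤ s_ℓ ≥ s_{ℓ+1} ≥ … ≥ s_k. In other words, every batch of a feasible solution is stack-unimodular. -/

import Mathlib

/-! # A model of the Side-Access Compact Retrieval Problem (SACRP)

A slice consists of stacks `0, 1, …, m-1`, stack `0` being on the
entry/exit side.  Stack `t` currently consists of unit loads at heights
`0, 1, …, h t - 1` (heights are 0-indexed from the bottom).  Targets are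
recorded by their current (stack, height) positions. -/

/-- An instance of the SACRP: `m` stacks with initial heights `height`,
and a pick-list `targets` of (stack, height) positions. -/
structure SACRP where
  m : ℕ
  height : ℕ → ℕ
  targets : Finset (ℕ × ℕ)

namespace SACRP

/-- Well-formedness: every target lies in an existing stack, at a height
below the top of its stack. -/
def WellFormed (I : SACRP) : Prop :=
  ∀ b ∈ I.targets, b.1 < I.m ∧ b.2 < I.height b.1

/-- `I.R b` : the number of targets initially positioned below `b` within
the same stack. -/
def R (I : SACRP) (b : ℕ × ℕ) : ℕ :=
  (I.targets.filter fun b' => b'.1 = b.1 ∧ b'.2 < b.2).card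

/-- A configuration during the retrieval process: current stack heights and
the current positions of the remaining (not yet retrieved) targets. -/
structure Config where
  height : ℕ → ℕ
  rem : Finset (ℕ × ℕ)

/-- The initial configuration of an instance. -/
def init (I : SACRP) : Config :=
  ⟨I.height, I.targets⟩

/-- A retrieval cycle: clearance levels `clear t` for every stack `t` (all
unit loads of stack `t` at heights `≥ clear t` are lifted for the whole
cycle), together with the sequence `seq` of retrieved targets, recorded by
their positions at the beginning of the cycle. -/
structure Cycle where
  clear : ℕ → ℕ
  seq : List (ℕ × ℕ)

/-- Residual height of stack `t` after the retrievals in `pre` have been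
performed in a cycle with clearance levels `clear`. -/
def dres (clear : ℕ → ℕ) (pre : List (ℕ × ℕ)) (t : ℕ) : ℕ :=
  clear t - (pre.filter fun b => b.1 = t).length

/-- Accessibility of the target at position `b` given residual heights `d`:
there is no unit load directly above it, and all stacks to its left have
residual height equal to its height. -/
def Accessible (d : ℕ → ℕ) (b : ℕ × ℕ) : Prop :=
  d b.1 = b.2 + 1 ∧ ∀ s < b.1, d s = b.2

/-- Validity of a cycle in a configuration: clearance levels are within
range, no target is retrieved twice, and every retrieved target is a
remaining target that is accessible at its retrieval step. -/
def ValidCycle (cfg : Config) (c : Cycle) : Prop :=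
  (∀ t, c.clear t ≤ cfg.height t) ∧ c.seq.Nodup ∧
    ∀ i : Fin c.seq.length,
      c.seq.get i ∈ cfg.rem ∧
        Accessible (dres c.clear (c.seq.take i)) (c.seq.get i)

/-- New position of a unit load after the unit loads at the positions in
`S` have been removed and the stacks have compacted downwards. -/
def fall (S : Finset (ℕ × ℕ)) (b : ℕ × ℕ) : ℕ × ℕ :=
  (b.1, b.2 - (S.filter fun a => a.1 = b.1 ∧ a.2 < b.2).card)

/-- The configuration obtained from `cfg` by removing a batch `S` of
positions and compacting all stacks downwards. -/
def removeBatch (cfg : Config) (S : Finset (ℕ × ℕ)) : Config :=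
  ⟨fun t => cfg.height t - (S.filter fun a => a.1 = t).card,
    (cfg.rem \ S).image (fall S)⟩

/-- The configuration at the end of a cycle: the retrieved targets are
removed, the lifted unit loads are lowered again and the stacks compact
downwards. -/
def Config.afterCycle (cfg : Config) (c : Cycle) : Config :=
  removeBatch cfg c.seq.toFinset

/-- Running a list of cycles from a configuration. -/
def runCycles (cfg : Config) : List Cycle → Config
  | [] => cfg
  | c :: cs => runCycles (cfg.afterCycle c) cs

/-- All cycles of a solution are valid, starting from configuration `cfg`. -/
def ValidFrom (cfg : Config) : List Cycle → Prop
  | [] => True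
  | c :: cs => ValidCycle cfg c ∧ ValidFrom (cfg.afterCycle c) cs

/-- A feasible solution of an instance: every cycle is valid and at the end
every target of the pick-list has been retrieved (exactly once, since
retrieved targets are removed from the configuration). -/
def Feasible (I : SACRP) (sol : List Cycle) : Prop :=
  ValidFrom I.init sol ∧ (runCycles I.init sol).rem = ∅

/-- A completion of a configuration: a valid sequence of cycles retrieving
all remaining targets. -/
def Completion (cfg : Config) (sol : List Cycle) : Prop :=
  ValidFrom cfg sol ∧ (runCycles cfg sol).rem = ∅

/-- Energy expenditure of one cycle: the number of lifted unit loads. -/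
def cycleEnergy (m : ℕ) (cfg : Config) (c : Cycle) : ℕ :=
  ∑ t ∈ Finset.range m, (cfg.height t - c.clear t)

/-- Total energy expenditure of a sequence of cycles started from `cfg`. -/
def energyFrom (m : ℕ) (cfg : Config) : List Cycle → ℕ
  | [] => 0
  | c :: cs => cycleEnergy m cfg c + energyFrom m (cfg.afterCycle c) cs

/-- Total energy expenditure of a solution. -/
def energy (I : SACRP) (sol : List Cycle) : ℕ :=
  energyFrom I.m I.init sol

/-! ## Geometry of batches -/

/-- The set of heights occurring in a batch. -/
def bheights (Y : Finset (ℕ × ℕ)) : Finset ℕ :=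
  Y.image Prod.snd

/-- The rightmost stack containing an element of the batch `Y` at height `x`. -/
def smax (Y : Finset (ℕ × ℕ)) (x : ℕ) : ℕ :=
  (Y.filter fun b => b.2 = x).sup Prod.fst

/-- Height-continuity: the distinct heights of the batch, listed in
increasing order, form a consecutive interval of integers. -/
def HeightContinuous (Y : Finset (ℕ × ℕ)) : Prop :=
  ((bheights Y).sort (· ≤ ·)).Chain' fun a b => b = a + 1

/-- `p` is a unimodal peak of the batch `Y`: the rightmost stacks `smax`
are non-decreasing on heights up to `p` and non-increasing from `p` on. -/
def IsPeak (Y : Finset (ℕ × ℕ)) (p : ℕ) : Prop :=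
  (∀ x ∈ bheights Y, ∀ y ∈ bheights Y, x ≤ y → y ≤ p → smax Y x ≤ smax Y y) ∧
  (∀ x ∈ bheights Y, ∀ y ∈ bheights Y, p ≤ x → x ≤ y → smax Y y ≤ smax Y x)

/-- Stack-unimodularity of a batch. -/
def StackUnimodular (Y : Finset (ℕ × ℕ)) : Prop :=
  ∃ p ∈ bheights Y, IsPeak Y p

/-- `x` and `y` are adjacent heights of the batch `Y` (`y` is the successor
height of `x` among the heights of `Y`). -/
def AdjHeights (Y : Finset (ℕ × ℕ)) (x y : ℕ) : Prop :=
  x ∈ bheights Y ∧ y ∈ bheights Y ∧ x < y ∧ ∀ z ∈ bheights Y, ¬(x < z ∧ z < y)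

/-- The unit load at position `b` belongs to `Y` or is absent (given the
current stack heights `H`). -/
def InOrAbsent (H : ℕ → ℕ) (Y : Finset (ℕ × ℕ)) (b : ℕ × ℕ) : Prop :=
  b ∈ Y ∨ H b.1 ≤ b.2

/-- Prefix-closedness of the batch `Y` with respect to the peak `p`: below
the peak, every unit load at the successor height in stacks up to `smax`
belongs to `Y` or is absent; symmetrically above the peak. -/
def PrefixCond (H : ℕ → ℕ) (Y : Finset (ℕ × ℕ)) (p : ℕ) : Prop :=
  ∀ x y, AdjHeights Y x y →
    (x < p → ∀ t ≤ smax Y x, InOrAbsent H Y (t, y)) ∧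
    (p < y → ∀ t ≤ smax Y y, InOrAbsent H Y (t, x))

/-- A weakly triangular batch: height-continuous, stack-unimodular and
prefix-closed (with respect to a common peak). -/
def WeaklyTriangular (H : ℕ → ℕ) (Y : Finset (ℕ × ℕ)) : Prop :=
  HeightContinuous Y ∧ ∃ p ∈ bheights Y, IsPeak Y p ∧ PrefixCond H Y p


theorem aux_dres_anti (clear : ℕ → ℕ) (l : List (ℕ × ℕ)) (t : ℕ) {i j : ℕ} (h : i ≤ j) :
    dres clear (l.take j) t ≤ dres clear (l.take i) t := by
  unfold dres
  have : ((l.take i).filter fun b => b.1 = t).length ≤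
      ((l.take j).filter fun b => b.1 = t).length :=
    ((List.take_sublist_take_left h).filter _).length_le
  omega

/-- Discrete intermediate value: crossing level `y` retrieves `(t, y)`. -/
theorem aux_cross (cfg : Config) (c : Cycle) (hv : ValidCycle cfg c) (t y j : ℕ)
    (hj : y + 1 ≤ dres c.clear (c.seq.take j) t) (k : ℕ) (hjk : j ≤ k)
    (hk : k ≤ c.seq.length) (hle : dres c.clear (c.seq.take k) t ≤ y) :
    (t, y) ∈ c.seq := by
  induction k, hjk using Nat.le_induction with
  | base => omega
  | succ k hjk ih =>
    by_cases h : dres c.clear (c.seq.take k) t ≤ y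
    · exact ih (by omega) h
    · have hkl : k < c.seq.length := by omega
      have hacc := (hv.2.2 ⟨k, hkl⟩).2.1
      simp only [List.get_eq_getElem] at hacc
      have hmem : c.seq[k] ∈ c.seq := List.getElem_mem hkl
      have htake : c.seq.take (k + 1) = c.seq.take k ++ [c.seq[k]] := by simp
      generalize c.seq[k] = b at *
      by_cases hb : b.1 = t
      · have h2 : dres c.clear (c.seq.take (k + 1)) t + 1 = dres c.clear (c.seq.take k) t := by
          rw [hb] at hacc
          rw [htake]
          simp only [dres, List.filter_append, List.length_append, List.filter_cons, hb] at hacc ⊢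
          simp
          omega
        rw [hb] at hacc
        have : b = (t, y) := by
          ext
          · exact hb
          · simp only
            omega
        exact this ▸ hmem
      · exfalso
        apply h
        rw [htake] at hle
        simpa [dres, List.filter_append, hb] using hle

theorem aux_le_smax {Y : Finset (ℕ × ℕ)} {t y : ℕ} (h : (t, y) ∈ Y) : t ≤ smax Y y := by
  have hm : (t, y) ∈ Y.filter fun b => b.2 = y := by simp [h]
  exact Finset.le_sup (f := Prod.fst) hm

theorem aux_smax_mem {Y : Finset (ℕ × ℕ)} {y : ℕ} (h : y ∈ bheights Y) : (smax Y y, y) ∈ Y := by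
  have hne : (Y.filter fun b => b.2 = y).Nonempty := by
    obtain ⟨b, hb, rfl⟩ := Finset.mem_image.1 h
    exact ⟨b, by simp [hb]⟩
  obtain ⟨b, hb, he⟩ := Finset.exists_mem_eq_sup _ hne Prod.fst
  have hb' := Finset.mem_filter.1 hb
  have : b = (smax Y y, y) := Prod.ext he.symm hb'.2
  exact this ▸ hb'.1

/-- There is no valley in the sequence of rightmost stacks. -/
theorem aux_no_valley (cfg : Config) (c : Cycle) (hv : ValidCycle cfg c) {x y z : ℕ}
    (hx : x ∈ bheights c.seq.toFinset) (hz : z ∈ bheights c.seq.toFinset)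
    (hxy : x < y) (hyz : y < z) :
    min (smax c.seq.toFinset x) (smax c.seq.toFinset z) ≤ smax c.seq.toFinset y := by
  have bx := List.mem_toFinset.1 (aux_smax_mem hx)
  have bz := List.mem_toFinset.1 (aux_smax_mem hz)
  generalize smax c.seq.toFinset x = sx at *
  generalize smax c.seq.toFinset z = sz at *
  obtain ⟨k, hk, ek⟩ := List.getElem_of_mem bx
  obtain ⟨j, hj, ej⟩ := List.getElem_of_mem bz
  have ak := (hv.2.2 ⟨k, hk⟩).2
  have aj := (hv.2.2 ⟨j, hj⟩).2
  simp only [List.get_eq_getElem, ek, ej, Accessible] at ak aj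
  have h1 : dres c.clear (c.seq.take k) (min sx sz) ≤ y := by
    rcases (min_le_left sx sz).eq_or_lt with h | h
    · rw [h, ak.1]; omega
    · rw [ak.2 _ h]; omega
  have h2 : y + 1 ≤ dres c.clear (c.seq.take j) (min sx sz) := by
    rcases (min_le_right sx sz).eq_or_lt with h | h
    · rw [h, aj.1]; omega
    · rw [aj.2 _ h]; omega
  have hjk : j ≤ k := by
    by_contra hcon
    have := aux_dres_anti c.clear c.seq (min sx sz) (show k ≤ j by omega)
    omega
  exact aux_le_smax (List.mem_toFinset.2 (aux_cross cfg c hv _ y j h2 k hjk hk.le h1))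

theorem aux_valid (sol : List Cycle) : ∀ cfg : Config, ValidFrom cfg sol →
    ∀ c ∈ sol, ∃ cfg', ValidCycle cfg' c := by
  induction sol with
  | nil => simp
  | cons a l ih =>
    intro cfg h c hc
    rcases List.mem_cons.1 hc with rfl | hc
    · exact ⟨cfg, h.1⟩
    · exact ih _ h.2 c hc

/-- In any feasible SACRP solution, consider a (nonempty)
cycle with batch `Y`; listing the distinct start-of-cycle heights of the
targets of `Y` as `h₁ < … < h_k` and setting
`s_i = max { s b : b ∈ Y, h_c b = h_i }`, there is an index `ℓ` with
`s₁ ≤ … ≤ s_ℓ ≥ … ≥ s_k`; that is, every batch of a feasible solution is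
stack-unimodular.  (The peak is expressed here as a height `p` occurring in
the batch such that `smax` is non-decreasing up to `p` and non-increasing
from `p` on.) -/
theorem batch_stack_unimodular (I : SACRP) (hwf : I.WellFormed)
    (sol : List Cycle) (hsol : I.Feasible sol) (c : Fin sol.length)
    (hne : (sol.get c).seq ≠ []) :
    StackUnimodular (sol.get c).seq.toFinset := by
  obtain ⟨cfg, hv⟩ := aux_valid sol _ hsol.1 (sol.get c) (List.get_mem _ _)
  generalize sol.get c = cyc at *
  have hY : (bheights cyc.seq.toFinset).Nonempty := by
    simpa [bheights] using hne
  obtain ⟨p, hp, hmax⟩ := Finset.exists_max_image _ (smax cyc.seq.toFinset) hY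
  refine ⟨p, hp, ?_, ?_⟩
  · intro x hx y hy hxy hyp
    rcases hxy.eq_or_lt with rfl | hxy
    · exact le_rfl
    rcases hyp.eq_or_lt with rfl | hyp
    · exact hmax x hx
    have := aux_no_valley cfg cyc hv hx hp hxy hyp
    rwa [min_eq_left (hmax x hx)] at this
  · intro x hx y hy hpx hxy
    rcases hxy.eq_or_lt with rfl | hxy
    · exact le_rfl
    rcases hpx.eq_or_lt with rfl | hpx
    · exact hmax y hy
    have := aux_no_valley cfg cyc hv hp hy hpx hxy
    rwa [min_eq_right (hmax y hy)] at this

end SACRP
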